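/- For the lattice Laplacian on ℤ³ and any F ≥ 0, the Green's function satisfies the pointwise exponential decay bound (-Δ_{ℤ³}+F)^{-1}(0,x) ≤ (2/(π‖x‖_∞)) (1+√F)^{-‖x‖_∞} for all x ≠ 0. -/

import Mathlib

open Real

/-- The modified Bessel function of the first kind of order `n`, via its integral
representation. -/
noncomputable def besselI (n : ℕ) (t : ℝ) : ℝ :=
  (t / 2) ^ n / (Real.sqrt π * Real.Gamma (n + 1 / 2)) *
    ∫ s in Set.Ioo (-1 : ℝ) 1, (1 - s ^ 2) ^ ((n : ℝ) - 1 / 2) * Real.exp (-(s * t))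

/-- The sup-norm `‖x‖_∞` of a point of `ℤ³`, as a natural number. -/
def ninf (x : Fin 3 → ℤ) : ℕ := Finset.univ.sup fun j => (x j).natAbs

/-- The Green's function `(-Δ_{ℤ³} + F)⁻¹(x,y)` of the lattice Laplacian on `ℤ³`,
via the heat kernel representation `∫₀^∞ e^{-6t} ∏ⱼ I_{|xʲ-yʲ|}(2t) e^{-Ft} dt`. -/
noncomputable def green3 (F : ℝ) (x y : Fin 3 → ℤ) : ℝ :=
  ∫ t in Set.Ioi (0 : ℝ),
    Real.exp (-(6 * t)) * (∏ j, besselI (x j - y j).natAbs (2 * t)) * Real.exp (-(F * t))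

lemma bes_nonneg (n : ℕ) (t : ℝ) (ht : 0 < t) : 0 ≤ besselI n t := by
  unfold besselI
  have hG : 0 < Real.Gamma ((n:ℝ) + 1/2) := Real.Gamma_pos_of_pos (by positivity)
  apply mul_nonneg (by positivity)
  apply MeasureTheory.setIntegral_nonneg measurableSet_Ioo
  intro s hs
  have : 0 ≤ 1 - s^2 := by nlinarith [hs.1, hs.2]
  positivity

lemma bes_bound (n : ℕ) (t : ℝ) (ht : 0 < t) :
    Real.exp (-t) * besselI n t ≤ 2 / Real.sqrt (π * t) := by
  have hG : 0 < Real.Gamma ((n:ℝ) + 1/2) := Real.Gamma_pos_of_pos (by positivity)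
  have hint : MeasureTheory.IntegrableOn (fun u : ℝ => u ^ ((n:ℝ) - 1/2) * Real.exp (-(t*u))) (Set.Ioi 0) := by
    have := integrableOn_rpow_mul_exp_neg_mul_rpow (p := 1) (s := (n:ℝ) - 1/2) (b := t)
      (by have : (0:ℝ) ≤ n := by positivity
          linarith) one_pos ht
    simpa using this
  have hval : ∫ u in Set.Ioi (0:ℝ), u ^ ((n:ℝ) - 1/2) * Real.exp (-(t*u))
      = (1/t)^((n:ℝ)+1/2) * Real.Gamma ((n:ℝ)+1/2) := by
    rw [← Real.integral_rpow_mul_exp_neg_mul_Ioi (by positivity) ht]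
    congr 1; ext u; congr 2; ring
  set g : ℝ → ℝ := fun u => u ^ ((n:ℝ) - 1/2) * Real.exp (-(t*u)) with hg
  have hi1 : MeasureTheory.IntegrableOn (fun s => g (1+s)) (Set.Ioi (-1)) := by
    have := (MeasureTheory.measurePreserving_add_left MeasureTheory.volume (1:ℝ)).integrableOn_comp_preimage
      (measurableEmbedding_addLeft 1) (f := g) (s := Set.Ioi 0)
    rw [← this] at hint
    simpa [Function.comp_def] using hint
  have hv1 : ∫ s in Set.Ioi (-1:ℝ), g (1+s) = ∫ u in Set.Ioi 0, g u := by
    have := (MeasureTheory.measurePreserving_add_left MeasureTheory.volume (1:ℝ)).setIntegral_preimage_emb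
      (measurableEmbedding_addLeft 1) g (Set.Ioi 0)
    simpa using this
  have hi2 : MeasureTheory.IntegrableOn (fun s => g (1-s)) (Set.Iio 1) := by
    have := (MeasureTheory.Measure.measurePreserving_sub_left MeasureTheory.volume (1:ℝ)).integrableOn_comp_preimage
      (MeasurableEquiv.subLeft 1).measurableEmbedding (f := g) (s := Set.Ioi 0)
    rw [← this] at hint
    simpa [Function.comp_def] using hint
  have hv2 : ∫ s in Set.Iio (1:ℝ), g (1-s) = ∫ u in Set.Ioi 0, g u := by
    have := (MeasureTheory.Measure.measurePreserving_sub_left MeasureTheory.volume (1:ℝ)).setIntegral_preimage_emb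
      (MeasurableEquiv.subLeft 1).measurableEmbedding g (Set.Ioi 0)
    simpa using this
  have hgn : ∀ u, 0 < u → 0 ≤ g u := fun u hu => by simp only [hg]; positivity
  have h1 : ∫ s in Set.Ioo (-1:ℝ) 1, g (1+s) ≤ ∫ u in Set.Ioi 0, g u := by
    rw [← hv1]
    apply MeasureTheory.setIntegral_mono_set hi1
    · filter_upwards [MeasureTheory.ae_restrict_mem measurableSet_Ioi] with s hs
      exact hgn _ (by have := Set.mem_Ioi.1 hs; linarith)
    · exact Set.Ioo_subset_Ioi_self.eventuallyLE
  have h2 : ∫ s in Set.Ioo (-1:ℝ) 1, g (1-s) ≤ ∫ u in Set.Ioi 0, g u := by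
    rw [← hv2]
    apply MeasureTheory.setIntegral_mono_set hi2
    · filter_upwards [MeasureTheory.ae_restrict_mem measurableSet_Iio] with s hs
      exact hgn _ (by have := Set.mem_Iio.1 hs; linarith)
    · exact Set.Ioo_subset_Iio_self.eventuallyLE
  have key : ∫ s in Set.Ioo (-1 : ℝ) 1, (1 - s ^ 2) ^ ((n : ℝ) - 1 / 2) * Real.exp (-(s * t))
      ≤ ∫ s in Set.Ioo (-1 : ℝ) 1, (2^n * Real.exp t) * (g (1+s) + g (1-s)) := by
    apply MeasureTheory.integral_mono_of_nonneg
    · filter_upwards [MeasureTheory.ae_restrict_mem measurableSet_Ioo] with s hs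
      have : 0 ≤ 1 - s^2 := by nlinarith [hs.1, hs.2]
      simp only [Pi.zero_apply]
      positivity
    · exact ((hi1.mono_set Set.Ioo_subset_Ioi_self).add (hi2.mono_set Set.Ioo_subset_Iio_self)).const_mul _
    · filter_upwards [MeasureTheory.ae_restrict_mem measurableSet_Ioo] with s hs
      obtain ⟨hs1, hs2⟩ := hs
      have aux : ∀ p q : ℝ, 0 < p → 1 ≤ q → q ≤ 2 → (p*q)^((n:ℝ)-1/2) ≤ 2^n * p^((n:ℝ)-1/2) := by
        intro p q hp hq hq2
        rw [Real.mul_rpow hp.le (by linarith), mul_comm]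
        gcongr
        calc q^((n:ℝ)-1/2) ≤ q^(n:ℝ) := Real.rpow_le_rpow_of_exponent_le hq (by linarith)
          _ ≤ 2^(n:ℝ) := by gcongr
          _ = 2^n := Real.rpow_natCast _ _
      rcases le_total s 0 with h | h
      · have a1 := aux (1-s) (1+s)
        have a2 := aux (1+s) (1-s) (by linarith) (by linarith) (by linarith)
        have e : 1 - s^2 = (1+s)*(1-s) := by ring
        rw [e]
        calc _ ≤ 2^n * (1+s)^((n:ℝ)-1/2) * Real.exp (-(s*t)) := by gcongr
          _ = 2^n * Real.exp t * g (1+s) := by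
            simp only [hg]
            have : Real.exp (-(s*t)) = Real.exp t * Real.exp (-(t*(1+s))) := by
              rw [← Real.exp_add]; congr 1; ring
            rw [this]; ring
          _ ≤ _ := by
            have := hgn (1-s) (by linarith)
            gcongr; linarith
      · have a2 := aux (1-s) (1+s) (by linarith) (by linarith) (by linarith)
        have e : 1 - s^2 = (1-s)*(1+s) := by ring
        rw [e]
        calc _ ≤ 2^n * (1-s)^((n:ℝ)-1/2) * Real.exp (s*t) := by
              have : 0 ≤ s*t := by positivity
              have h3 : 0 < 1 - s := by linarith
              gcongr; linarith
          _ = 2^n * Real.exp t * g (1-s) := by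
            simp only [hg]
            have : Real.exp (s*t) = Real.exp t * Real.exp (-(t*(1-s))) := by
              rw [← Real.exp_add]; congr 1; ring
            rw [this]; ring
          _ ≤ _ := by
            have := hgn (1+s) (by linarith)
            gcongr; linarith
  rw [MeasureTheory.integral_const_mul, MeasureTheory.integral_add (hi1.mono_set Set.Ioo_subset_Ioi_self) (hi2.mono_set Set.Ioo_subset_Iio_self)] at key
  have hp : (1/t)^((n:ℝ)+1/2) = (1/t)^n * (1/Real.sqrt t) := by
    rw [Real.rpow_add (by positivity), Real.rpow_natCast, ← Real.sqrt_eq_rpow]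
    simp
  unfold besselI
  calc _ ≤ Real.exp (-t) * ((t / 2) ^ n / (Real.sqrt π * Real.Gamma (n + 1 / 2)) *
        (2 ^ n * Real.exp t * (2 * ((1/t)^((n:ℝ)+1/2) * Real.Gamma ((n:ℝ)+1/2))))) := by
        gcongr
        refine key.trans ?_
        gcongr
        rw [← hval]; linarith
    _ = 2 / Real.sqrt (π * t) := by
        rw [hp, Real.sqrt_mul Real.pi_pos.le, Real.exp_neg]
        field_simp
        rw [← mul_pow, ← mul_pow]
        have : t / 2 * 2 * (1 / t) = 1 := by field_simp
        rw [this, one_pow]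

lemma r_exists (F : ℝ) (hF : 0 < F) : ∃ r : ℝ, 0 < r ∧ r < 1 ∧ 1 + r^2 = r * (2+F) ∧
    r ≤ (1 + Real.sqrt F)⁻¹ := by
  have hs := Real.sq_sqrt (show 0 ≤ F^2+4*F by positivity)
  set q := Real.sqrt (F^2+4*F) with hq
  have hq0 : 0 < q := Real.sqrt_pos.2 (by positivity)
  have hqF : F < q := by nlinarith
  have hq2 : q < 2 + F := by nlinarith
  have e : 1 + ((2+F-q)/2)^2 = (2+F-q)/2 * (2+F) := by nlinarith
  refine ⟨(2+F-q)/2, by linarith, by linarith, e, ?_⟩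
  set r := (2+F-q)/2 with hr
  have hr0 : 0 < r := by linarith
  have hr1 : r < 1 := by linarith
  have hf := Real.sq_sqrt hF.le
  have hf0 := Real.sqrt_nonneg F
  rw [← one_div, le_div_iff₀ (by positivity)]
  have : (r * Real.sqrt F)^2 ≤ (1-r)^2 := by
    rw [mul_pow, hf]; nlinarith [mul_pos hr0 hF]
  have := abs_le_of_sq_le_sq this (by linarith)
  linarith [le_abs_self (r * Real.sqrt F)]

lemma sin_int (n : ℕ) : ∫ x in (0:ℝ)..π, Real.sin x ^ (2*n) =
    Real.sqrt π * Real.Gamma ((n:ℝ)+1/2) / n.factorial := by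
  induction n with
  | zero =>
    have : Real.Gamma (1/2) = Real.sqrt π := Real.Gamma_one_half_eq
    simp only [Nat.cast_zero, zero_add, this]
    simp [Real.mul_self_sqrt Real.pi_pos.le]
  | succ n ih =>
    rw [show 2*(n+1) = 2*n+2 by ring, integral_sin_pow, ih]
    have : Real.Gamma (((n+1:ℕ):ℝ)+1/2) = ((n:ℝ)+1/2) * Real.Gamma ((n:ℝ)+1/2) := by
      rw [← Real.Gamma_add_one (by positivity)]; congr 1; push_cast; ring
    rw [this, Nat.factorial_succ]
    push_cast
    simp
    field_simp

lemma cov (n : ℕ) (hn : 1 ≤ n) (F r : ℝ) (hF : 0 < F) (hr0 : 0 < r) (hr1 : r < 1)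
    (hr : 1 + r^2 = r * (2+F)) :
    ∫ s in (-1:ℝ)..1, (1 - s^2)^((n:ℝ)-1/2) / (2+F+2*s)^n =
      r^n * (Real.sqrt π * Real.Gamma ((n:ℝ)+1/2) / n.factorial) := by
  have hn' : (1:ℝ) ≤ n := by exact_mod_cast hn
  have hwp : ∀ φ : ℝ, 0 < 1 - r^2 * Real.sin φ^2 := fun φ => by
    nlinarith [Real.sin_sq_le_one φ, sq_nonneg r, Real.sin_sq_add_cos_sq φ]
  set w : ℝ → ℝ := fun φ => Real.sqrt (1 - r^2 * Real.sin φ^2) with hw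
  have hw0 : ∀ φ, 0 < w φ := fun φ => Real.sqrt_pos.2 (hwp φ)
  have hwsq : ∀ φ, w φ^2 = 1 - r^2 * Real.sin φ^2 := fun φ => Real.sq_sqrt (hwp φ).le
  have hwr : ∀ φ, r * Real.cos φ < w φ := fun φ => by
    apply Real.lt_sqrt_of_sq_lt
    nlinarith [Real.sin_sq_add_cos_sq φ]
  have hwc : Continuous w := by simp only [hw]; fun_prop
  set h : ℝ → ℝ := fun φ => -(w φ * Real.cos φ + r * Real.sin φ^2) with hh
  set h' : ℝ → ℝ := fun φ => Real.sin φ * (w φ - r * Real.cos φ) * (1 - r * Real.cos φ / w φ) with hh'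
  have hder : ∀ φ, HasDerivAt h (h' φ) φ := by
    intro φ
    have d1 : HasDerivAt (fun φ => 1 - r^2 * Real.sin φ^2) (-(r^2 * (2 * Real.sin φ * Real.cos φ))) φ := by
      have := ((((Real.hasDerivAt_sin φ).pow 2).const_mul (r^2)).const_sub 1)
      refine this.congr_deriv ?_
      simp
    have d2 := d1.sqrt (hwp φ).ne'
    have d3 := ((d2.mul (Real.hasDerivAt_cos φ)).add (((Real.hasDerivAt_sin φ).pow 2).const_mul r)).neg
    refine HasDerivAt.congr_deriv (f := h) d3 ?_
    have := hw0 φ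
    change -(-(r^2 * (2 * Real.sin φ * Real.cos φ)) / (2 * w φ) * Real.cos φ + w φ * (-Real.sin φ) + _) = h' φ
    simp only [hh']
    field_simp
    simp
    ring
  have hid : ∀ φ, 1 - h φ^2 = (Real.sin φ * (w φ - r * Real.cos φ))^2 := by
    intro φ
    have e1 := hwsq φ
    have e2 := Real.sin_sq_add_cos_sq φ
    have : Real.cos φ^2 = 1 - Real.sin φ^2 := by linarith
    simp only [hh]
    ring_nf
    rw [e1, this]
    ring
  have hd : ∀ φ, r * (2 + F + 2 * h φ) = (w φ - r * Real.cos φ)^2 := by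
    intro φ
    have e1 := hwsq φ
    have e2 := Real.sin_sq_add_cos_sq φ
    have e3 : Real.cos φ^2 = 1 - Real.sin φ^2 := by linarith
    have : (w φ - r * Real.cos φ)^2 = w φ^2 - 2*r*w φ*Real.cos φ + r^2*Real.cos φ^2 := by ring
    rw [this, e1, e3]
    simp only [hh]
    linear_combination -hr
  have hdpos : ∀ φ, 0 < 2 + F + 2 * h φ := by
    intro φ
    have : 0 < r * (2 + F + 2 * h φ) := by
      rw [hd]; have := hwr φ; exact pow_pos (by linarith) 2
    exact (mul_pos_iff_of_pos_left hr0).1 this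
  have hh0 : h 0 = -1 := by simp [hh, hw]
  have hhpi : h π = 1 := by simp [hh, hw]
  have hrange : ∀ φ, h φ ∈ Set.Icc (-1:ℝ) 1 := by
    intro φ
    have : 0 ≤ 1 - h φ^2 := by rw [hid]; positivity
    rw [Set.mem_Icc, ← abs_le, ← sq_le_one_iff_abs_le_one]; linarith
  have hcs : ∫ φ in (0:ℝ)..π, ((fun s => (1 - s^2)^((n:ℝ)-1/2) / (2+F+2*s)^n) ∘ h) φ * h' φ
      = ∫ s in h 0..h π, (1 - s^2)^((n:ℝ)-1/2) / (2+F+2*s)^n := by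
    apply intervalIntegral.integral_comp_mul_deriv' (fun φ _ => hder φ)
    · apply Continuous.continuousOn
      simp only [hh']
      have : ∀ φ, w φ ≠ 0 := fun φ => (hw0 φ).ne'
      fun_prop (disch := assumption)
    · apply ContinuousOn.div
      · apply ContinuousOn.rpow_const (by fun_prop)
        intro s _; right; linarith
      · fun_prop
      · rintro s ⟨φ, _, rfl⟩
        exact (pow_pos (hdpos φ) n).ne'
  rw [hh0, hhpi] at hcs
  rw [← hcs]
  have hpt : ∀ φ ∈ Set.uIcc 0 π, ((fun s => (1 - s^2)^((n:ℝ)-1/2) / (2+F+2*s)^n) ∘ h) φ * h' φ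
      = r^n * (Real.sin φ^(2*n)) - r^n * (Real.sin φ^(2*n) * (r * Real.cos φ / w φ)) := by
    intro φ hφ
    rw [Set.uIcc_of_le Real.pi_pos.le] at hφ
    have hsin := Real.sin_nonneg_of_mem_Icc hφ
    have hk : 0 < w φ - r * Real.cos φ := by linarith [hwr φ]
    simp only [Function.comp, hid, hh']
    set k := w φ - r * Real.cos φ with hkd
    have e1 : ((Real.sin φ * k)^2)^((n:ℝ)-1/2) * (Real.sin φ * k) = (Real.sin φ * k)^(2*n) := by
      rcases hsin.eq_or_lt with h0 | h0
      · rw [← h0, zero_mul, mul_zero, zero_pow (by omega)]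
      · have hp : 0 < Real.sin φ * k := by positivity
        rw [← Real.rpow_natCast (_) 2, ← Real.rpow_mul hp.le, ← Real.rpow_add_one hp.ne', ← Real.rpow_natCast]
        congr 1; push_cast; ring
    have e2 : (2 + F + 2 * h φ)^n = k^(2*n) / r^n := by
      rw [eq_div_iff (by positivity), ← mul_pow, mul_comm, hd, ← pow_mul]
    rw [e2]
    calc _ = ((Real.sin φ * k)^2)^((n:ℝ)-1/2) * (Real.sin φ * k) / (k^(2*n) / r^n) * (1 - r * Real.cos φ / w φ) := by ring
      _ = _ := by
        rw [e1, mul_pow]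
        have := hw0 φ
        field_simp
  have hwn : ∀ φ, w φ ≠ 0 := fun φ => (hw0 φ).ne'
  rw [intervalIntegral.integral_congr hpt, intervalIntegral.integral_sub, intervalIntegral.integral_const_mul, intervalIntegral.integral_const_mul, sin_int]
  · have odd : ∫ φ in (0:ℝ)..π, Real.sin φ^(2*n) * (r * Real.cos φ / w φ) = 0 := by
      have := intervalIntegral.integral_comp_sub_left (a := 0) (b := π) (fun φ => Real.sin φ^(2*n) * (r * Real.cos φ / w φ)) π
      have hww : ∀ φ, w (π - φ) = w φ := fun φ => by simp [hw]
      simp only [Real.sin_pi_sub, Real.cos_pi_sub, hww, sub_self, sub_zero, mul_neg, neg_div, intervalIntegral.integral_neg] at this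
      linarith
    rw [odd]; ring
  · exact Continuous.intervalIntegrable (by fun_prop) _ _
  · exact Continuous.intervalIntegrable (by fun_prop (disch := assumption)) _ _


lemma mainB (n : ℕ) (hn : 1 ≤ n) (F : ℝ) (hF : 0 < F) :
    ∫⁻ t in Set.Ioi (0:ℝ), ENNReal.ofReal (Real.exp (-(2*t)) * besselI n (2*t) * Real.exp (-(F*t)) / t)
      ≤ ENNReal.ofReal (1 / n * (1 + Real.sqrt F)^(-(n:ℤ))) := by
  obtain ⟨r, hr0, hr1, hr, hrF⟩ := r_exists F hF
  have hG : 0 < Real.Gamma ((n:ℝ) + 1/2) := Real.Gamma_pos_of_pos (by positivity)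
  have hn0 : (0:ℝ) < n := by exact_mod_cast hn
  have hn' : (1:ℝ) ≤ n := by exact_mod_cast hn
  set c : ℝ := 1 / (Real.sqrt π * Real.Gamma ((n:ℝ)+1/2)) with hc
  have hc0 : 0 < c := by positivity
  set f : ℝ → ℝ → ℝ := fun t s =>
    c * (1 - s^2)^((n:ℝ)-1/2) * (t^((n:ℝ)-1) * Real.exp (-((2+F+2*s)*t))) with hf
  have hm : Measurable (Function.uncurry fun t s => ENNReal.ofReal (f t s)) := by
    simp only [hf, Function.uncurry_def]
    fun_prop
  calc _ ≤ ∫⁻ t in Set.Ioi (0:ℝ), ∫⁻ s in Set.Ioo (-1:ℝ) 1, ENNReal.ofReal (f t s) := by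
        apply MeasureTheory.setLIntegral_mono' measurableSet_Ioi
        intro t ht
        have ht : 0 < t := ht
        have e : Real.exp (-(2*t)) * besselI n (2*t) * Real.exp (-(F*t)) / t =
            ∫ s in Set.Ioo (-1:ℝ) 1, f t s := by
          unfold besselI
          rw [show 2 * t / 2 = t by ring]
          rw [← MeasureTheory.integral_const_mul, ← MeasureTheory.integral_const_mul,
            ← MeasureTheory.integral_mul_const, ← MeasureTheory.integral_div]
          congr 1; ext s
          simp only [hf, hc]
          rw [Real.rpow_sub_one ht.ne', Real.rpow_natCast,
            show -((2+F+2*s)*t) = -(2*t) + -(F*t) + -(s*(2*t)) by ring, Real.exp_add, Real.exp_add]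
          ring
        rw [e]
        refine (Real.ofReal_le_enorm _).trans ((MeasureTheory.enorm_integral_le_lintegral_enorm _).trans ?_)
        apply MeasureTheory.setLIntegral_mono' measurableSet_Ioo
        intro s hs
        have : 0 ≤ 1 - s^2 := by nlinarith [hs.1, hs.2]
        rw [Real.enorm_of_nonneg]
        simp only [hf]; positivity
    _ = ∫⁻ s in Set.Ioo (-1:ℝ) 1, ∫⁻ t in Set.Ioi (0:ℝ), ENNReal.ofReal (f t s) :=
        MeasureTheory.lintegral_lintegral_swap hm.aemeasurable
    _ = ∫⁻ s in Set.Ioo (-1:ℝ) 1, ENNReal.ofReal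
          (c * Real.Gamma n * ((1 - s^2)^((n:ℝ)-1/2) / (2+F+2*s)^n)) := by
        apply MeasureTheory.setLIntegral_congr_fun measurableSet_Ioo
        intro s hs
        have h1 : 0 ≤ 1 - s^2 := by nlinarith [hs.1, hs.2]
        have h2 : 0 < 2+F+2*s := by linarith [hs.1]
        have hint : MeasureTheory.IntegrableOn (fun t : ℝ => t^((n:ℝ)-1) * Real.exp (-((2+F+2*s)*t))) (Set.Ioi 0) := by
          have := integrableOn_rpow_mul_exp_neg_mul_rpow (p := 1) (s := (n:ℝ) - 1) (b := 2+F+2*s)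
            (by linarith) one_pos h2
          simpa only [Real.rpow_one, neg_mul] using this
        have hv := Real.integral_rpow_mul_exp_neg_mul_Ioi hn0 h2
        simp only [hf]
        rw [← MeasureTheory.ofReal_integral_eq_lintegral_ofReal (hint.const_mul _)]
        · rw [MeasureTheory.integral_const_mul, hv, Real.rpow_natCast]
          congr 1
          rw [one_div_pow]
          ring
        · filter_upwards [MeasureTheory.ae_restrict_mem measurableSet_Ioi] with t ht
          have ht : 0 < t := ht
          simp only [Pi.zero_apply]
          positivity
    _ = ENNReal.ofReal (c * Real.Gamma n * (r^n * (Real.sqrt π * Real.Gamma ((n:ℝ)+1/2) / n.factorial))) := by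
        rw [← cov n hn F r hF hr0 hr1 hr, ← MeasureTheory.ofReal_integral_eq_lintegral_ofReal]
        · rw [intervalIntegral.integral_of_le (by norm_num), MeasureTheory.integral_Ioc_eq_integral_Ioo,
            MeasureTheory.integral_const_mul]
        · refine MeasureTheory.IntegrableOn.mono_set (t := Set.Icc (-1:ℝ) 1) ?_ Set.Ioo_subset_Icc_self
          apply ContinuousOn.integrableOn_Icc
          apply ContinuousOn.mul continuousOn_const
          apply ContinuousOn.div
          · apply ContinuousOn.rpow_const (by fun_prop)
            intro s _; right; linarith
          · fun_prop
          · intro s hs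
            have : 0 < 2+F+2*s := by linarith [hs.1]
            positivity
        · filter_upwards [MeasureTheory.ae_restrict_mem measurableSet_Ioo] with s hs
          have h1 : 0 ≤ 1 - s^2 := by nlinarith [hs.1, hs.2]
          have h2 : 0 < 2+F+2*s := by linarith [hs.1]
          have := Real.Gamma_pos_of_pos hn0
          simp only [Pi.zero_apply]
          positivity
    _ ≤ _ := by
        apply ENNReal.ofReal_le_ofReal
        have e : Real.Gamma n = n.factorial / n := by
          rw [eq_div_iff hn0.ne', mul_comm, ← Real.Gamma_add_one hn0.ne', Real.Gamma_nat_eq_factorial]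
        have : c * Real.Gamma n * (r^n * (Real.sqrt π * Real.Gamma ((n:ℝ)+1/2) / n.factorial)) = 1/n * r^n := by
          rw [e, hc]; field_simp
        rw [this, zpow_neg, zpow_natCast, ← inv_pow]
        gcongr

lemma mainB' (n : ℕ) (hn : 1 ≤ n) (F : ℝ) (hF : 0 ≤ F) :
    ∫⁻ t in Set.Ioi (0:ℝ), ENNReal.ofReal (Real.exp (-(2*t)) * besselI n (2*t) * Real.exp (-(F*t)) / t)
      ≤ ENNReal.ofReal (1 / n * (1 + Real.sqrt F)^(-(n:ℤ))) := by
  rcases hF.eq_or_lt with rfl | hF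
  swap
  · exact mainB n hn F hF
  set g : ℝ → ENNReal := fun t => ENNReal.ofReal (Real.exp (-(2*t)) * besselI n (2*t) / t) with hg
  have hsplit : ∀ F t : ℝ, ENNReal.ofReal (Real.exp (-(2*t)) * besselI n (2*t) * Real.exp (-(F*t)) / t)
      = g t * ENNReal.ofReal (Real.exp (-(F*t))) := by
    intro F t
    rw [hg, ← ENNReal.ofReal_mul' (by positivity)]
    congr 1; ring
  have hbm : Measurable (besselI n) := by
    unfold besselI
    apply Measurable.mul (by fun_prop)
    have : MeasureTheory.StronglyMeasurable (Function.uncurry fun t s : ℝ =>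
        (1 - s ^ 2) ^ ((n:ℝ) - 1 / 2) * Real.exp (-(s * t))) := by
      apply Measurable.stronglyMeasurable
      simp only [Function.uncurry_def]
      fun_prop
    exact this.integral_prod_right.measurable
  have hgm : Measurable g := by simp only [hg]; fun_prop
  have hlim : ∀ t, Filter.liminf (fun k : ℕ => g t * ENNReal.ofReal (Real.exp (-((1/((k:ℝ)+1))*t)))) Filter.atTop
      = g t * ENNReal.ofReal (Real.exp (-(0*t))) := by
    intro t
    apply Filter.Tendsto.liminf_eq
    apply ENNReal.Tendsto.const_mul
    · apply ENNReal.tendsto_ofReal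
      have h0 := tendsto_one_div_add_atTop_nhds_zero_nat (𝕜 := ℝ)
      exact (Real.continuous_exp.tendsto _).comp ((h0.mul_const t).neg)
    · left; simp
  simp_rw [hsplit, ← hlim]
  refine (MeasureTheory.lintegral_liminf_le (fun k => by fun_prop)).trans ?_
  apply Filter.liminf_le_of_le
  · isBoundedDefault
  intro b hb
  obtain ⟨k, hk⟩ := hb.exists
  refine hk.trans ?_
  have := mainB n hn (1/((k:ℝ)+1)) (by positivity)
  simp_rw [hsplit] at this
  refine this.trans ?_
  apply ENNReal.ofReal_le_ofReal
  have h1 : (1:ℝ) ≤ 1 + Real.sqrt (1/((k:ℝ)+1)) := by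
    have := Real.sqrt_nonneg (1/((k:ℝ)+1)); linarith
  rw [zpow_neg, zpow_natCast, zpow_neg, zpow_natCast]
  simp only [Real.sqrt_zero, add_zero, one_pow, inv_one]
  gcongr
  exact inv_le_one_of_one_le₀ (one_le_pow₀ h1)

lemma prod_bound (m : Fin 3 → ℕ) (i : Fin 3) (t : ℝ) (ht : 0 < t) :
    Real.exp (-(6*t)) * ∏ j, besselI (m j) (2*t) ≤
      2/π * (Real.exp (-(2*t)) * besselI (m i) (2*t) / t) := by
  have key : ∀ a b c : ℕ, Real.exp (-(6*t)) * (besselI a (2*t) * besselI b (2*t) * besselI c (2*t)) ≤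
      2/π * (Real.exp (-(2*t)) * besselI a (2*t) / t) := by
    intro a b c
    have h2 : 0 < 2*t := by positivity
    have ha := bes_nonneg a _ h2
    have hb := bes_nonneg b _ h2
    have hc := bes_nonneg c _ h2
    have hb' := bes_bound b _ h2
    have hc' := bes_bound c _ h2
    have hm := mul_le_mul hb' hc' (by positivity) (by positivity)
    rw [div_mul_div_comm, Real.mul_self_sqrt (by positivity)] at hm
    have e : Real.exp (-(6*t)) = Real.exp (-(2*t)) * Real.exp (-(2*t)) * Real.exp (-(2*t)) := by
      rw [← Real.exp_add, ← Real.exp_add]; congr 1; ring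
    rw [e]
    calc _ = (Real.exp (-(2*t)) * besselI a (2*t)) * (Real.exp (-(2*t)) * besselI b (2*t) * (Real.exp (-(2*t)) * besselI c (2*t))) := by ring
      _ ≤ (Real.exp (-(2*t)) * besselI a (2*t)) * (2*2/(π*(2*t))) := by gcongr
      _ = _ := by field_simp
  rw [Fin.prod_univ_three]
  fin_cases i
  · exact key _ _ _
  · have := key (m 1) (m 0) (m 2)
    rw [mul_comm (besselI (m 1) _)] at this
    exact this
  · have := key (m 2) (m 0) (m 1)
    rw [mul_assoc, mul_comm (besselI (m 2) _)] at this
    exact this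

theorem green3_decay (F : ℝ) (hF : 0 ≤ F) (x : Fin 3 → ℤ) (hx : x ≠ 0) :
    green3 F 0 x ≤ 2 / (π * ninf x) * (1 + Real.sqrt F) ^ (-(ninf x : ℤ)) := by
  obtain ⟨i, -, hi⟩ := Finset.exists_mem_eq_sup (Finset.univ : Finset (Fin 3)) Finset.univ_nonempty
    (fun j => (x j).natAbs)
  have hi : ninf x = (x i).natAbs := hi
  have hn : 1 ≤ ninf x := by
    by_contra h
    apply hx
    ext j
    have h1 : (x j).natAbs ≤ ninf x := Finset.le_sup (f := fun j => (x j).natAbs) (Finset.mem_univ j)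
    simp only [Pi.zero_apply]
    omega
  set n := ninf x with hnn
  have hn0 : (0:ℝ) < n := by exact_mod_cast hn
  set B := 2 / (π * n) * (1 + Real.sqrt F) ^ (-(n : ℤ)) with hB
  have hB0 : 0 ≤ B := by positivity
  have hm : ∀ j, ((0 : Fin 3 → ℤ) j - x j).natAbs = (x j).natAbs := fun j => by simp
  suffices h : ENNReal.ofReal (green3 F 0 x) ≤ ENNReal.ofReal B from (ENNReal.ofReal_le_ofReal_iff hB0).1 h
  unfold green3
  refine (Real.ofReal_le_enorm _).trans ((MeasureTheory.enorm_integral_le_lintegral_enorm _).trans ?_)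
  simp only [hm]
  calc _ ≤ ∫⁻ t in Set.Ioi (0:ℝ), ENNReal.ofReal (2/π) *
          ENNReal.ofReal (Real.exp (-(2*t)) * besselI n (2*t) * Real.exp (-(F*t)) / t) := by
        apply MeasureTheory.setLIntegral_mono' measurableSet_Ioi
        intro t ht
        have ht : 0 < t := ht
        have hp := prod_bound (fun j => (x j).natAbs) i t ht
        have hpn : 0 ≤ ∏ j, besselI (x j).natAbs (2*t) :=
          Finset.prod_nonneg fun j _ => bes_nonneg _ _ (by positivity)
        rw [Real.enorm_of_nonneg (by positivity), ← ENNReal.ofReal_mul (by positivity)]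
        apply ENNReal.ofReal_le_ofReal
        simp only [← hi] at hp
        calc _ ≤ 2/π * (Real.exp (-(2*t)) * besselI n (2*t) / t) * Real.exp (-(F*t)) := by gcongr
          _ = _ := by ring
    _ = ENNReal.ofReal (2/π) * ∫⁻ t in Set.Ioi (0:ℝ), 
          ENNReal.ofReal (Real.exp (-(2*t)) * besselI n (2*t) * Real.exp (-(F*t)) / t) :=
        MeasureTheory.lintegral_const_mul' _ _ ENNReal.ofReal_ne_top
    _ ≤ ENNReal.ofReal (2/π) * ENNReal.ofReal (1 / n * (1 + Real.sqrt F)^(-(n:ℤ))) := by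
        gcongr
        exact mainB' n hn F hF
    _ = ENNReal.ofReal B := by
        rw [← ENNReal.ofReal_mul (by positivity)]
        congr 1
        rw [hB]; field_simp
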